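/- Let n ≥ 2, s ∈ (0,1) and x₀ ∈ ℝⁿ \ {0}. Then the function h(r) := ∫_{∂B_r} |x₀ − y|^{−(n+s)} dH^{n−1}(y) is strictly increasing on the interval (0, |x₀|). -/

import Mathlib

open MeasureTheory Filter Metric Set

theorem lipschitzOnWith_norm_inv_smul {E : Type*} [NormedAddCommGroup E] [NormedSpace ℝ E] :
    LipschitzOnWith 2 (fun x : E => ‖x‖⁻¹ • x) {x | 1 ≤ ‖x‖} := by
  refine LipschitzOnWith.of_dist_le_mul fun x hx y hy => ?_
  simp only [mem_ofPred_eq] at hx hy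
  have hx0 : 0 < ‖x‖ := by linarith
  have hy0 : 0 < ‖y‖ := by linarith
  have hxi : ‖x‖⁻¹ ≤ 1 := inv_le_one_of_one_le₀ hx
  have hdecomp : ‖x‖⁻¹ • x - ‖y‖⁻¹ • y = ‖x‖⁻¹ • (x - y) + (‖x‖⁻¹ - ‖y‖⁻¹) • y := by
    module
  have hcoef : ‖(‖x‖⁻¹ - ‖y‖⁻¹) • y‖ = ‖x‖⁻¹ * |‖y‖ - ‖x‖| := by
    have : (‖x‖⁻¹ - ‖y‖⁻¹) = ‖x‖⁻¹ * (‖y‖ - ‖x‖) * ‖y‖⁻¹ := by field_simp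
    rw [norm_smul, this, norm_mul, norm_mul, Real.norm_eq_abs, Real.norm_eq_abs, Real.norm_eq_abs,
      abs_of_pos (inv_pos.2 hx0), abs_of_pos (inv_pos.2 hy0)]
    field_simp
  rw [dist_eq_norm, dist_eq_norm, hdecomp]
  calc _ ≤ ‖‖x‖⁻¹ • (x - y)‖ + ‖(‖x‖⁻¹ - ‖y‖⁻¹) • y‖ := norm_add_le _ _
    _ = ‖x‖⁻¹ * (‖x - y‖ + |‖y‖ - ‖x‖|) := by
        rw [hcoef, norm_smul, norm_inv, norm_norm]; ring
    _ ≤ 1 * (‖x - y‖ + ‖x - y‖) := by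
        gcongr
        rw [abs_sub_comm]
        exact abs_norm_sub_norm_le x y
    _ = _ := by push_cast; ring

theorem hausdorffMeasure_unitSphere_lt_top (m : ℕ) :
    μH[(m : ℝ)] (sphere (0 : EuclideanSpace ℝ (Fin (m + 1))) 1) < ⊤ := by
  let φ : Fin (m + 1) × Bool → (Fin m → ℝ) → EuclideanSpace ℝ (Fin (m + 1)) := fun j y =>
    WithLp.toLp 2 (j.1.insertNth (bif j.2 then (1 : ℝ) else -1) y : Fin (m + 1) → ℝ)
  let N : EuclideanSpace ℝ (Fin (m + 1)) → EuclideanSpace ℝ (Fin (m + 1)) := fun x => ‖x‖⁻¹ • x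
  have hcover : sphere (0 : EuclideanSpace ℝ (Fin (m + 1))) 1 ⊆
      ⋃ j, N ∘ φ j '' closedBall 0 1 := by
    intro x hx
    have hx1 : ‖x‖ = 1 := by simpa using hx
    obtain ⟨i, hi⟩ := Finite.exists_max fun i => |x i|
    have hM : 0 < |x i| := by
      by_contra! h
      have : x = 0 := by
        ext k
        exact abs_nonpos_iff.1 ((hi k).trans h)
      simp [this] at hx1
    refine mem_iUnion.2 ⟨(i, decide (0 < x i)), fun k => |x i|⁻¹ * x (i.succAbove k), ?_, ?_⟩
    · rw [mem_closedBall_zero_iff, pi_norm_le_iff_of_nonneg zero_le_one]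
      intro k
      rw [norm_mul, norm_inv, Real.norm_eq_abs, Real.norm_eq_abs, abs_abs, inv_mul_le_iff₀ hM,
        mul_one]
      exact hi _
    · have hφ : φ (i, decide (0 < x i)) (fun k => |x i|⁻¹ * x (i.succAbove k)) =
          |x i|⁻¹ • x := by
        ext k
        refine Fin.succAboveCases i ?_ (fun k => ?_) k
        · rcases lt_or_ge 0 (x i) with h | h
          · simp [φ, h, abs_of_pos h, h.ne']
          · have h' : x i < 0 := lt_of_le_of_ne h (abs_pos.1 hM)
            simp [φ, h.not_gt, abs_of_neg h', h'.ne]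
        · simp [φ]
      simp [N, hφ, norm_smul, hx1, smul_smul, hM.ne']
  have hφ1 : ∀ j y, 1 ≤ ‖φ j y‖ := by
    rintro ⟨i, b⟩ y
    refine le_trans ?_ (PiLp.norm_apply_le (φ (i, b) y) i)
    cases b <;> simp [φ]
  have hφL : ∀ j, ∃ K, LipschitzOnWith K (N ∘ φ j) (closedBall 0 1) := by
    intro j
    have h1 : LipschitzWith 1 fun y : Fin m → ℝ =>
        (j.1.insertNth (bif j.2 then (1 : ℝ) else -1) y : Fin (m + 1) → ℝ) :=
      LipschitzWith.of_dist_le_mul fun y z => by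
        simp [Fin.dist_insertNth_insertNth]
    have h2 := (PiLp.lipschitzWith_toLp 2 fun _ : Fin (m + 1) => ℝ).comp h1
    exact ⟨_, lipschitzOnWith_norm_inv_smul.comp h2.lipschitzOnWith fun y _ => hφ1 j y⟩
  refine (measure_mono hcover).trans_lt ((measure_iUnion_le _).trans_lt ?_)
  rw [tsum_fintype]
  refine ENNReal.sum_lt_top.2 fun j _ => ?_
  obtain ⟨K, hK⟩ := hφL j
  refine (hK.hausdorffMeasure_image_le m.cast_nonneg).trans_lt (ENNReal.mul_lt_top ?_ ?_)
  · exact ENNReal.rpow_lt_top_of_nonneg m.cast_nonneg ENNReal.coe_ne_top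
  · have := hausdorffMeasure_pi_real (ι := Fin m)
    rw [Fintype.card_fin] at this
    rw [this]
    exact measure_closedBall_lt_top

theorem hausdorffMeasure_unitSphere_pos (m : ℕ) :
    0 < μH[(m : ℝ)] (sphere (0 : EuclideanSpace ℝ (Fin (m + 1))) 1) := by
  let P : EuclideanSpace ℝ (Fin (m + 1)) → (Fin m → ℝ) := fun x k => x k.succ
  have hP : LipschitzWith 1 P := LipschitzWith.of_dist_le_mul fun x y => by
    rw [NNReal.coe_one, one_mul, dist_pi_le_iff dist_nonneg]
    intro k
    rw [dist_eq_norm, dist_eq_norm]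
    exact PiLp.norm_apply_le (x - y) k.succ
  have hsub : closedBall (0 : Fin m → ℝ) ((m + 1 : ℝ)⁻¹) ⊆
      P '' sphere (0 : EuclideanSpace ℝ (Fin (m + 1))) 1 := by
    intro y hy
    rw [mem_closedBall_zero_iff, pi_norm_le_iff_of_nonneg (by positivity)] at hy
    have hsum : ∑ k, y k ^ 2 ≤ 1 := by
      calc ∑ k, y k ^ 2 ≤ ∑ _k : Fin m, ((m + 1 : ℝ)⁻¹) ^ 2 :=
            Finset.sum_le_sum fun k _ => sq_le_sq' (abs_le.1 (hy k)).1 (abs_le.1 (hy k)).2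
        _ = m * ((m + 1 : ℝ)⁻¹) ^ 2 := by simp
        _ ≤ 1 := by
          rw [inv_pow, mul_inv_le_iff₀ (by positivity)]
          nlinarith [(m.cast_nonneg : (0 : ℝ) ≤ m)]
    refine ⟨WithLp.toLp 2 (Fin.cons (√(1 - ∑ k, y k ^ 2)) y), ?_, ?_⟩
    · rw [mem_sphere_zero_iff_norm, EuclideanSpace.norm_eq, Real.sqrt_eq_one, Fin.sum_univ_succ]
      simp [Real.sq_sqrt (sub_nonneg.2 hsum)]
    · ext k
      simp [P]
  have hle := hP.hausdorffMeasure_image_le (m.cast_nonneg : (0 : ℝ) ≤ m)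
    (sphere (0 : EuclideanSpace ℝ (Fin (m + 1))) 1)
  simp only [ENNReal.coe_one, ENNReal.one_rpow, one_mul] at hle
  refine lt_of_lt_of_le ?_ ((measure_mono hsub).trans hle)
  have := hausdorffMeasure_pi_real (ι := Fin m)
  rw [Fintype.card_fin] at this
  rw [this]
  exact measure_closedBall_pos _ _ (by positivity)

theorem setIntegral_sphere_hausdorffMeasure {E : Type*} [NormedAddCommGroup E] [NormedSpace ℝ E]
    [MeasurableSpace E] [BorelSpace E] {d r : ℝ} (hd : 0 ≤ d) (hr : 0 < r) (f : E → ℝ) :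
    ∫ y in sphere (0 : E) r, f y ∂μH[d] = ∫ y in sphere (0 : E) 1, r ^ d * f (r • y) ∂μH[d] := by
  have hmap := map_homothety_hausdorffMeasure (P := E) hd (0 : E) hr.ne'
  have hemb : MeasurableEmbedding (AffineMap.homothety (0 : E) r) := by
    have : (⇑(AffineMap.homothety (0 : E) r)) = fun y => r • y := by
      ext y; simp [AffineMap.homothety_apply]
    rw [this]
    exact (Homeomorph.smulOfNeZero r hr.ne').measurableEmbedding
  have hpre : AffineMap.homothety (0 : E) r ⁻¹' sphere (0 : E) r = sphere 0 1 := by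
    ext y
    simp [AffineMap.homothety_apply, norm_smul, abs_of_pos hr, hr.ne']
  have h := hemb.setIntegral_map (μ := μH[d]) f (sphere 0 r)
  rw [hmap, hpre, Measure.restrict_smul, integral_smul_nnreal_measure] at h
  rw [integral_const_mul]
  simp only [AffineMap.homothety_apply, vsub_eq_sub, sub_zero, vadd_eq_add, add_zero] at h
  rw [← h, NNReal.smul_def, smul_eq_mul, ← mul_assoc]
  have : r ^ d * ((‖r‖₊⁻¹ ^ d : NNReal) : ℝ) = 1 := by
    push_cast
    rw [Real.norm_of_nonneg hr.le, Real.inv_rpow hr.le,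
      mul_inv_cancel₀ (Real.rpow_pos_of_pos hr d).ne']
  rw [this, one_mul]

theorem sq_sub_two_mul_add_sq_pos {a r t : ℝ} (hr : r ∈ Ioo 0 a) (ht : t ≤ 1) :
    0 < a ^ 2 - 2 * a * r * t + r ^ 2 := by
  have h1 : 0 < a - r := sub_pos.2 hr.2
  have h2 : 0 < a * r := mul_pos (hr.1.trans hr.2) hr.1
  nlinarith [sq_pos_of_pos h1, mul_nonneg h2.le (sub_nonneg.2 ht)]

theorem hasDerivAt_rpow_mul_kernel {a r t d p : ℝ} (hr : r ∈ Ioo 0 a) (ht : t ≤ 1) :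
    HasDerivAt (fun r => r ^ d * (a ^ 2 - 2 * a * r * t + r ^ 2) ^ (-p / 2))
      (r ^ (d - 1) * (a ^ 2 - 2 * a * r * t + r ^ 2) ^ (-p / 2 - 1) *
        (d * (a ^ 2 - 2 * a * r * t + r ^ 2) - p * r * (r - a * t))) r := by
  have hQ := sq_sub_two_mul_add_sq_pos hr ht
  have h1 : HasDerivAt (fun r => a ^ 2 - 2 * a * r * t + r ^ 2) (-2 * a * t + 2 * r) r := by
    have := ((((hasDerivAt_id r).const_mul (2 * a)).mul_const t).const_sub (a ^ 2)).add
      ((hasDerivAt_id r).pow 2)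
    refine this.congr_deriv ?_
    simp
  refine ((Real.hasDerivAt_rpow_const (p := d) (Or.inl hr.1.ne')).mul
    (h1.rpow_const (p := -p / 2) (Or.inl hQ.ne'))).congr_deriv ?_
  rw [show r ^ d = r ^ (d - 1) * r by rw [← Real.rpow_add_one hr.1.ne', sub_add_cancel],
    show (a ^ 2 - 2 * a * r * t + r ^ 2) ^ (-p / 2) =
      (a ^ 2 - 2 * a * r * t + r ^ 2) ^ (-p / 2 - 1) * (a ^ 2 - 2 * a * r * t + r ^ 2) by
        rw [← Real.rpow_add_one hQ.ne', sub_add_cancel]]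
  ring

theorem strictMonoOn_rpow_mul_kernel {a t d s : ℝ} (hd : 2 ≤ d) (hs : s ∈ Ioo (0 : ℝ) 1)
    (ht : t ≤ 1) :
    StrictMonoOn (fun r => r ^ d * (a ^ 2 - 2 * a * r * t + r ^ 2) ^ (-(d + 1 + s) / 2))
      (Ioo 0 a) := by
  refine strictMonoOn_of_deriv_pos (convex_Ioo 0 a)
    (fun r hr => (hasDerivAt_rpow_mul_kernel hr ht).continuousAt.continuousWithinAt)
    fun r hr => ?_
  rw [interior_Ioo] at hr
  rw [(hasDerivAt_rpow_mul_kernel hr ht).deriv]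
  refine mul_pos (mul_pos (Real.rpow_pos_of_pos hr.1 _)
    (Real.rpow_pos_of_pos (sq_sub_two_mul_add_sq_pos hr ht) _)) ?_
  have ha : 0 < a := hr.1.trans hr.2
  have h1 : 0 < a - r := sub_pos.2 hr.2
  have h2 : 0 ≤ d - 1 - s := by linarith [hs.2]
  have h3 : 0 < (1 + s) * ((a - r) * (a + r)) :=
    mul_pos (by linarith [hs.1]) (mul_pos h1 (by linarith [hr.1]))
  have h4 : 0 ≤ (d - 1 - s) * (a * r * (1 - t) + a * (a - r)) :=
    mul_nonneg h2 (add_nonneg (mul_nonneg (mul_pos ha hr.1).le (sub_nonneg.2 ht))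
      (mul_pos ha h1).le)
  nlinarith

theorem hasDerivAt_sin_mul_kernel {a r θ p : ℝ} (hr : r ∈ Ioo 0 a) :
    HasDerivAt (fun θ => Real.sin θ * (a ^ 2 - 2 * a * r * Real.cos θ + r ^ 2) ^ (-p / 2))
      ((a ^ 2 - 2 * a * r * Real.cos θ + r ^ 2) ^ (-p / 2 - 1) *
        (Real.cos θ * (a ^ 2 - 2 * a * r * Real.cos θ + r ^ 2) -
          p * a * r * (1 - Real.cos θ ^ 2))) θ := by
  have hQ := sq_sub_two_mul_add_sq_pos hr (Real.cos_le_one θ)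
  have h1 : HasDerivAt (fun θ => a ^ 2 - 2 * a * r * Real.cos θ + r ^ 2)
      (2 * a * r * Real.sin θ) θ := by
    refine ((((Real.hasDerivAt_cos θ).const_mul (2 * a * r)).const_sub (a ^ 2)).add_const
      (r ^ 2)).congr_deriv ?_
    ring
  refine ((Real.hasDerivAt_sin θ).mul
    (h1.rpow_const (p := -p / 2) (Or.inl hQ.ne'))).congr_deriv ?_
  rw [← Real.sin_sq,
    show (a ^ 2 - 2 * a * r * Real.cos θ + r ^ 2) ^ (-p / 2) =
      (a ^ 2 - 2 * a * r * Real.cos θ + r ^ 2) ^ (-p / 2 - 1) *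
        (a ^ 2 - 2 * a * r * Real.cos θ + r ^ 2) by
        rw [← Real.rpow_add_one hQ.ne', sub_add_cancel]]
  ring

theorem kernel_radial_sub_angular_pos {a r t s : ℝ} (hr : r ∈ Ioo 0 a) (hs : s ∈ Ioo (0 : ℝ) 1)
    (ht : t ∈ Icc (-1 : ℝ) 1) :
    0 < (a ^ 2 - 2 * a * r * t + r ^ 2 - (2 + s) * r * (r - a * t)) -
      s * r / (2 * a) *
        (t * (a ^ 2 - 2 * a * r * t + r ^ 2) - (2 + s) * a * r * (1 - t ^ 2)) := by
  obtain ⟨hr0, hra⟩ := hr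
  have ha : 0 < a := hr0.trans hra
  have h1 : 0 < a - r := sub_pos.2 hra
  have hs0 := hs.1
  have key : (a ^ 2 - 2 * a * r * t + r ^ 2 - (2 + s) * r * (r - a * t)) -
      s * r / (2 * a) *
        (t * (a ^ 2 - 2 * a * r * t + r ^ 2) - (2 + s) * a * r * (1 - t ^ 2)) =
      (1 + t) / 2 * ((a - r) * (2 * a * (a + r) + s * r * (a + r)) / (2 * a)) +
      (1 - t) / 2 * ((a + r) * (a - r) * (2 * a - s * r) / (2 * a)) +
      s ^ 2 * r ^ 2 / 2 * (1 - t ^ 2) := by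
    field_simp
    ring
  have hP : 0 < (a - r) * (2 * a * (a + r) + s * r * (a + r)) / (2 * a) := by positivity
  have hM : 0 < (a + r) * (a - r) * (2 * a - s * r) / (2 * a) := by
    have : 0 < 2 * a - s * r := by nlinarith [hs.2]
    positivity
  rw [key]
  have ht1 : 0 ≤ 1 - t ^ 2 := by nlinarith [ht.1, ht.2]
  have h3 : 0 ≤ s ^ 2 * r ^ 2 / 2 * (1 - t ^ 2) := by positivity
  rcases le_or_gt t 0 with h | h
  · have : 0 < (1 - t) / 2 * ((a + r) * (a - r) * (2 * a - s * r) / (2 * a)) :=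
      mul_pos (by linarith) hM
    have := mul_nonneg (by linarith [ht.1] : 0 ≤ (1 + t) / 2) hP.le
    linarith
  · have : 0 < (1 + t) / 2 * ((a - r) * (2 * a * (a + r) + s * r * (a + r)) / (2 * a)) :=
      mul_pos (by linarith) hP
    have := mul_nonneg (by linarith [ht.2] : 0 ≤ (1 - t) / 2) hM.le
    linarith

theorem integral_deriv_kernel_pos {a r s : ℝ} (hr : r ∈ Ioo 0 a) (hs : s ∈ Ioo (0 : ℝ) 1) :
    0 < ∫ θ in (0)..(2 * Real.pi),
      r ^ ((1 : ℝ) - 1) * (a ^ 2 - 2 * a * r * Real.cos θ + r ^ 2) ^ (-(1 + 1 + s) / 2 - 1) *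
        (1 * (a ^ 2 - 2 * a * r * Real.cos θ + r ^ 2) -
          (1 + 1 + s) * r * (r - a * Real.cos θ)) := by
  have hQ : ∀ θ, 0 < a ^ 2 - 2 * a * r * Real.cos θ + r ^ 2 := fun θ =>
    sq_sub_two_mul_add_sq_pos hr (Real.cos_le_one θ)
  have hcont : ∀ q : ℝ, Continuous fun θ => (a ^ 2 - 2 * a * r * Real.cos θ + r ^ 2) ^ q :=
    fun q => Continuous.rpow_const (by fun_prop) fun θ => Or.inl (hQ θ).ne'
  have hc := hcont (-(1 + 1 + s) / 2 - 1)
  let Ψ' : ℝ → ℝ := fun θ => (a ^ 2 - 2 * a * r * Real.cos θ + r ^ 2) ^ (-(1 + 1 + s) / 2 - 1) *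
        (Real.cos θ * (a ^ 2 - 2 * a * r * Real.cos θ + r ^ 2) -
          (1 + 1 + s) * a * r * (1 - Real.cos θ ^ 2))
  have hΨc : Continuous Ψ' := by fun_prop
  have hΨ : ∫ θ in (0)..(2 * Real.pi), Ψ' θ = 0 := by
    rw [intervalIntegral.integral_eq_sub_of_hasDerivAt
      (fun θ _ => hasDerivAt_sin_mul_kernel hr) (hΨc.intervalIntegrable _ _)]
    simp
  let Φ' : ℝ → ℝ := fun θ => r ^ ((1 : ℝ) - 1) *
    (a ^ 2 - 2 * a * r * Real.cos θ + r ^ 2) ^ (-(1 + 1 + s) / 2 - 1) *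
        (1 * (a ^ 2 - 2 * a * r * Real.cos θ + r ^ 2) -
          (1 + 1 + s) * r * (r - a * Real.cos θ))
  have hΦc : Continuous Φ' := by fun_prop
  change 0 < ∫ θ in (0)..(2 * Real.pi), Φ' θ
  have hzero : ∫ θ in (0)..(2 * Real.pi), s * r / (2 * a) * Ψ' θ = 0 := by
    rw [intervalIntegral.integral_const_mul, hΨ, mul_zero]
  refine lt_of_lt_of_eq ?_ ((intervalIntegral.integral_sub
    (hΦc.intervalIntegrable _ _)
    ((hΨc.const_mul (s * r / (2 * a))).intervalIntegrable _ _)).trans (by rw [hzero, sub_zero]))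
  refine intervalIntegral.intervalIntegral_pos_of_pos
    (Continuous.intervalIntegrable (by fun_prop) _ _) (fun θ => ?_) Real.two_pi_pos
  have hpos := mul_pos (Real.rpow_pos_of_pos (hQ θ) (-(1 + 1 + s) / 2 - 1))
    (kernel_radial_sub_angular_pos hr hs ⟨Real.neg_one_le_cos θ, Real.cos_le_one θ⟩)
  refine hpos.trans_eq ?_
  simp only [Φ', Ψ', sub_self, Real.rpow_zero]
  ring

theorem strictMonoOn_integral_circle_kernel {a s : ℝ} (hs : s ∈ Ioo (0 : ℝ) 1) :
    StrictMonoOn (fun r => ∫ θ in (0)..(2 * Real.pi),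
      r ^ (1 : ℝ) * (a ^ 2 - 2 * a * r * Real.cos θ + r ^ 2) ^ (-(1 + 1 + s) / 2))
      (Ioo 0 a) := by
  intro r₁ h₁ r₂ h₂ h12
  have hmem : ∀ r ∈ Icc r₁ r₂, r ∈ Ioo 0 a := fun r hr =>
    ⟨h₁.1.trans_le hr.1, hr.2.trans_lt h₂.2⟩
  let F : ℝ → ℝ → ℝ := fun r θ =>
      r ^ ((1 : ℝ) - 1) * (a ^ 2 - 2 * a * r * Real.cos θ + r ^ 2) ^ (-(1 + 1 + s) / 2 - 1) *
        (1 * (a ^ 2 - 2 * a * r * Real.cos θ + r ^ 2) -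
          (1 + 1 + s) * r * (r - a * Real.cos θ))
  have hF : ContinuousOn F.uncurry (Icc r₁ r₂ ×ˢ Icc 0 (2 * Real.pi)) := by
    refine ContinuousOn.mul (ContinuousOn.mul ?_ ?_) (by fun_prop)
    · exact ContinuousOn.rpow_const (by fun_prop) fun x hx => Or.inl (hmem _ hx.1).1.ne'
    · exact ContinuousOn.rpow_const (by fun_prop) fun x hx =>
        Or.inl (sq_sub_two_mul_add_sq_pos (hmem _ hx.1) (Real.cos_le_one _)).ne'
  have hFi : IntegrableOn F.uncurry (uIoc r₁ r₂ ×ˢ uIoc 0 (2 * Real.pi)) := by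
    rw [uIoc_of_le h12.le, uIoc_of_le Real.two_pi_pos.le]
    exact (hF.integrableOn_compact (isCompact_Icc.prod isCompact_Icc)).mono_set
      (prod_mono Ioc_subset_Icc_self Ioc_subset_Icc_self)
  have hk : ∀ r ∈ Ioo 0 a, IntervalIntegrable (fun θ =>
      r ^ (1 : ℝ) * (a ^ 2 - 2 * a * r * Real.cos θ + r ^ 2) ^ (-(1 + 1 + s) / 2))
      volume 0 (2 * Real.pi) := fun r hr =>
    (Continuous.mul continuous_const (Continuous.rpow_const (by fun_prop) fun θ =>
      Or.inl (sq_sub_two_mul_add_sq_pos hr (Real.cos_le_one θ)).ne')).intervalIntegrable _ _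
  have hinner : ∀ θ, ∫ r in r₁..r₂, F r θ =
      r₂ ^ (1 : ℝ) * (a ^ 2 - 2 * a * r₂ * Real.cos θ + r₂ ^ 2) ^ (-(1 + 1 + s) / 2) -
      r₁ ^ (1 : ℝ) * (a ^ 2 - 2 * a * r₁ * Real.cos θ + r₁ ^ 2) ^ (-(1 + 1 + s) / 2) := by
    intro θ
    rw [← uIcc_of_le h12.le] at hmem
    refine intervalIntegral.integral_eq_sub_of_hasDerivAt
      (fun r hr => hasDerivAt_rpow_mul_kernel (hmem r hr) (Real.cos_le_one θ))
      (ContinuousOn.intervalIntegrable ?_)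
    refine ContinuousOn.mul (ContinuousOn.mul ?_ ?_) (by fun_prop)
    · exact ContinuousOn.rpow_const (by fun_prop) fun x hx => Or.inl (hmem _ hx).1.ne'
    · exact ContinuousOn.rpow_const (by fun_prop) fun x hx =>
        Or.inl (sq_sub_two_mul_add_sq_pos (hmem _ hx) (Real.cos_le_one _)).ne'
  rw [← sub_pos]
  simp only
  rw [← intervalIntegral.integral_sub (hk r₂ h₂) (hk r₁ h₁)]
  simp_rw [← hinner]
  rw [← intervalIntegral_intervalIntegral_swap hFi]
  refine intervalIntegral.intervalIntegral_pos_of_pos_on ?_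
    (fun r hr => integral_deriv_kernel_pos (hmem r (Ioo_subset_Icc_self hr)) hs) h12
  rw [intervalIntegrable_iff]
  rw [IntegrableOn, Measure.volume_eq_prod, ← Measure.prod_restrict] at hFi
  have := hFi.integral_prod_left
  simpa only [IntegrableOn, intervalIntegral.integral_of_le Real.two_pi_pos.le,
    uIoc_of_le Real.two_pi_pos.le, Function.uncurry_apply_pair] using this

theorem norm_sub_smul_rpow_neg {E : Type*} [NormedAddCommGroup E] [InnerProductSpace ℝ E]
    {x y : E} (hx : x ≠ 0) (hy : ‖y‖ = 1) (r p : ℝ) :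
    ‖x - r • y‖ ^ (-p) =
      (‖x‖ ^ 2 - 2 * ‖x‖ * r * (inner ℝ x y / ‖x‖) + r ^ 2) ^ (-p / 2) := by
  have hx' := norm_ne_zero_iff.2 hx
  have : ‖x‖ ^ 2 - 2 * ‖x‖ * r * (inner ℝ x y / ‖x‖) + r ^ 2 = ‖x - r • y‖ ^ 2 := by
    rw [norm_sub_sq_real, inner_smul_right, norm_smul, hy, mul_one, Real.norm_eq_abs, sq_abs]
    field_simp
  rw [this, ← Real.rpow_natCast, ← Real.rpow_mul (norm_nonneg _)]
  congr 1
  push_cast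
  ring

theorem inner_div_norm_le_one {E : Type*} [NormedAddCommGroup E] [InnerProductSpace ℝ E]
    (x : E) {y : E} (hy : ‖y‖ = 1) : inner ℝ x y / ‖x‖ ≤ 1 := by
  refine div_le_one_of_le₀ ?_ (norm_nonneg x)
  simpa [hy] using real_inner_le_norm x y

theorem integral_unitSphere_lt_of_forall_lt {E : Type*} [NormedAddCommGroup E]
    [InnerProductSpace ℝ E] [FiniteDimensional ℝ E] [MeasurableSpace E] [BorelSpace E]
    {μ : Measure E} (hfin : μ (sphere 0 1) < ⊤) (hpos : 0 < μ (sphere 0 1)) {f g : E → ℝ}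
    (hf : ContinuousOn f (sphere 0 1)) (hg : ContinuousOn g (sphere 0 1))
    (hlt : ∀ y ∈ sphere (0 : E) 1, f y < g y) :
    ∫ y in sphere 0 1, f y ∂μ < ∫ y in sphere 0 1, g y ∂μ := by
  have : IsFiniteMeasure (μ.restrict (sphere 0 1)) := isFiniteMeasure_restrict.2 hfin.ne
  have hint : ∀ {u : E → ℝ}, ContinuousOn u (sphere 0 1) → IntegrableOn u (sphere 0 1) μ := by
    intro u hu
    have := hu.integrableOn_compact (μ := μ.restrict (sphere 0 1)) (isCompact_sphere 0 1)
    rwa [IntegrableOn, Measure.restrict_restrict isClosed_sphere.measurableSet, inter_self] at this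
  rw [← sub_pos, ← integral_sub (hint hg) (hint hf),
    setIntegral_pos_iff_support_of_nonneg_ae]
  · refine hpos.trans_le (measure_mono fun y hy => ⟨(sub_pos.2 (hlt y hy)).ne', hy⟩)
  · exact (ae_restrict_mem isClosed_sphere.measurableSet).mono fun y hy =>
      (sub_pos.2 (hlt y hy)).le
  · exact (hint hg).sub (hint hf)

theorem setIntegral_unitSphere_comp_linearIsometryEquiv {E : Type*} [NormedAddCommGroup E]
    [NormedSpace ℝ E] [MeasurableSpace E] [BorelSpace E] (d : ℝ) (L : E ≃ₗᵢ[ℝ] E) (f : E → ℝ) :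
    ∫ y in sphere (0 : E) 1, f (L y) ∂μH[d] = ∫ y in sphere (0 : E) 1, f y ∂μH[d] := by
  have h := (L.toIsometryEquiv.measurePreserving_hausdorffMeasure d).setIntegral_preimage_emb
    L.toHomeomorph.measurableEmbedding f (sphere 0 1)
  have hpre : L.toIsometryEquiv ⁻¹' sphere (0 : E) 1 = sphere 0 1 := by
    ext y; simp
  rw [hpre] at h
  exact h

/-- The integral over the unit circle of a function of `⟪x, ·⟫` is a multiple of an integral over
an angle. -/
theorem two_pi_mul_integral_unitCircle {x : EuclideanSpace ℝ (Fin 2)} (hx : x ≠ 0)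
    {f : ℝ → ℝ} (hf : ContinuousOn f (Iic 1)) (d : ℝ)
    (hfin : μH[d] (sphere (0 : EuclideanSpace ℝ (Fin 2)) 1) < ⊤) :
    2 * Real.pi * ∫ y in sphere (0 : EuclideanSpace ℝ (Fin 2)) 1, f (inner ℝ x y / ‖x‖) ∂μH[d] =
      (μH[d]).real (sphere (0 : EuclideanSpace ℝ (Fin 2)) 1) *
        ∫ θ in (0)..(2 * Real.pi), f (Real.cos θ) := by
  let E := EuclideanSpace ℝ (Fin 2)
  let e : ℂ ≃ₗᵢ[ℝ] E := Complex.orthonormalBasisOneI.repr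
  let R : ℝ → E ≃ₗᵢ[ℝ] E := fun θ => (e.symm.trans (rotation (Circle.exp θ))).trans e
  have hR : ∀ θ y, R θ y = e (Complex.exp (θ * Complex.I) * e.symm y) := fun θ y => by
    simp [R, rotation_apply, Circle.coe_exp]
  have hRc : Continuous fun q : ℝ × E => R q.1 q.2 := by
    simp only [hR]
    fun_prop
  have : IsFiniteMeasure ((μH[d]).restrict (sphere (0 : E) 1)) :=
    isFiniteMeasure_restrict.2 hfin.ne
  have hcos : ∀ y ∈ sphere (0 : E) 1, ∃ α : ℝ, ∀ θ : ℝ,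
      inner ℝ x (R θ y) / ‖x‖ = Real.cos (θ + α) := by
    intro y hy
    have hy1 : ‖e.symm y‖ = 1 := by simpa using hy
    have hx' : ‖x‖ ≠ 0 := norm_ne_zero_iff.2 hx
    refine ⟨((starRingEnd ℂ) (e.symm x) * e.symm y).arg, fun θ => ?_⟩
    have h1 : inner ℝ x (R θ y) = inner ℝ (e.symm x) (Complex.exp (θ * Complex.I) * e.symm y) := by
      rw [hR, ← e.inner_map_map (e.symm x), e.apply_symm_apply]
    set z := (starRingEnd ℂ) (e.symm x) * e.symm y with hz
    have hzn : ‖z‖ = ‖x‖ := by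
      rw [hz, norm_mul, hy1, mul_one, RCLike.norm_conj, e.symm.norm_map]
    have h2 : Complex.exp (θ * Complex.I) * e.symm y * (starRingEnd ℂ) (e.symm x) =
        ‖x‖ * Complex.exp (((θ + z.arg : ℝ) : ℂ) * Complex.I) := by
      rw [mul_assoc, mul_comm (e.symm y), ← hz]
      conv_lhs => rw [← Complex.norm_mul_exp_arg_mul_I z, hzn]
      push_cast
      rw [add_mul, Complex.exp_add]
      ring
    rw [h1, Complex.inner, h2, Complex.re_ofReal_mul,
      Complex.exp_ofReal_mul_I_re, mul_div_cancel_left₀ _ hx']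
  have hInt : Integrable (Function.uncurry fun θ y => f (inner ℝ x (R θ y) / ‖x‖))
      ((volume.restrict (uIoc 0 (2 * Real.pi))).prod ((μH[d]).restrict (sphere (0 : E) 1))) := by
    have hc : ContinuousOn (Function.uncurry fun θ y => f (inner ℝ x (R θ y) / ‖x‖))
        (Icc 0 (2 * Real.pi) ×ˢ sphere (0 : E) 1) := by
      refine hf.comp (Continuous.continuousOn ?_) fun q hq => ?_
      · exact (continuous_const.inner hRc).div_const _
      · exact inner_div_norm_le_one x (by simpa using hq.2)
    have := (hc.integrableOn_compact
      (μ := volume.prod ((μH[d]).restrict (sphere (0 : E) 1)))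
      (isCompact_Icc.prod (isCompact_sphere 0 1))).mono_set
      (prod_mono (uIoc_subset_uIcc.trans (uIcc_of_le Real.two_pi_pos.le).subset) Subset.rfl)
    rwa [IntegrableOn, ← Measure.prod_restrict,
      Measure.restrict_restrict isClosed_sphere.measurableSet, inter_self] at this
  have hinner : ∀ y ∈ sphere (0 : E) 1, ∫ θ in (0)..(2 * Real.pi), f (inner ℝ x (R θ y) / ‖x‖) =
      ∫ θ in (0)..(2 * Real.pi), f (Real.cos θ) := by
    intro y hy
    obtain ⟨α, hα⟩ := hcos y hy
    have hper : Function.Periodic (fun θ => f (Real.cos θ)) (2 * Real.pi) := fun θ => by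
      simp only [Real.cos_add_two_pi]
    simp_rw [hα]
    rw [intervalIntegral.integral_comp_add_right fun θ => f (Real.cos θ)]
    simpa [add_comm] using hper.intervalIntegral_add_eq α 0
  calc _ = ∫ _θ in (0)..(2 * Real.pi), ∫ y in sphere (0 : E) 1, f (inner ℝ x y / ‖x‖) ∂μH[d] := by
        simp [E]
    _ = ∫ θ in (0)..(2 * Real.pi),
          ∫ y in sphere (0 : E) 1, f (inner ℝ x (R θ y) / ‖x‖) ∂μH[d] := by
        congr 1
        ext θ
        exact (setIntegral_unitSphere_comp_linearIsometryEquiv d (R θ)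
          fun y => f (inner ℝ x y / ‖x‖)).symm
    _ = ∫ y in sphere (0 : E) 1,
          (∫ θ in (0)..(2 * Real.pi), f (inner ℝ x (R θ y) / ‖x‖)) ∂μH[d] :=
        intervalIntegral_integral_swap hInt
    _ = ∫ _y in sphere (0 : E) 1, (∫ θ in (0)..(2 * Real.pi), f (Real.cos θ)) ∂μH[d] :=
        setIntegral_congr_fun isClosed_sphere.measurableSet hinner
    _ = _ := by rw [setIntegral_const, smul_eq_mul]

theorem sphere_integral_strictMono (n : ℕ) (hn : 2 ≤ n) (s : ℝ)
    (hs : s ∈ Set.Ioo (0 : ℝ) 1)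
    (x₀ : EuclideanSpace ℝ (Fin n)) (hx₀ : x₀ ≠ 0) :
    StrictMonoOn
      (fun r : ℝ =>
        ∫ y in Metric.sphere (0 : EuclideanSpace ℝ (Fin n)) r,
          ‖x₀ - y‖ ^ (-((n : ℝ) + s)) ∂μH[(n : ℝ) - 1])
      (Set.Ioo 0 ‖x₀‖) := by
  obtain ⟨m, rfl⟩ : ∃ m, n = m + 1 := ⟨n - 1, by omega⟩
  let K : ℝ → ℝ → ℝ := fun r t =>
    r ^ (m : ℝ) * (‖x₀‖ ^ 2 - 2 * ‖x₀‖ * r * t + r ^ 2) ^ (-((m : ℝ) + 1 + s) / 2)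
  have hK : ∀ r ∈ Ioo 0 ‖x₀‖, ContinuousOn (K r) (Iic 1) := fun r hr =>
    continuousOn_const.mul (ContinuousOn.rpow_const (by fun_prop) fun t ht =>
      Or.inl (sq_sub_two_mul_add_sq_pos hr ht).ne')
  have hfin := hausdorffMeasure_unitSphere_lt_top m
  have hpos := hausdorffMeasure_unitSphere_pos m
  have hI : ∀ r ∈ Ioo 0 ‖x₀‖, ∫ y in sphere (0 : EuclideanSpace ℝ (Fin (m + 1))) r,
      ‖x₀ - y‖ ^ (-(((m + 1 : ℕ) : ℝ) + s)) ∂μH[((m + 1 : ℕ) : ℝ) - 1] =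
      ∫ y in sphere (0 : EuclideanSpace ℝ (Fin (m + 1))) 1, K r (inner ℝ x₀ y / ‖x₀‖)
        ∂μH[(m : ℝ)] := by
    intro r hr
    rw [Nat.cast_succ, add_sub_cancel_right,
      setIntegral_sphere_hausdorffMeasure m.cast_nonneg hr.1]
    refine setIntegral_congr_fun isClosed_sphere.measurableSet fun y hy => ?_
    simp only [K, norm_sub_smul_rpow_neg hx₀ (mem_sphere_zero_iff_norm.1 hy)]
  intro r₁ h₁ r₂ h₂ h12
  simp only
  rw [hI r₁ h₁, hI r₂ h₂]
  rcases (show m = 1 ∨ 2 ≤ m by omega) with rfl | hm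
  · refine lt_of_mul_lt_mul_left ?_ Real.two_pi_pos.le
    rw [two_pi_mul_integral_unitCircle hx₀ (hK r₁ h₁) _ hfin,
      two_pi_mul_integral_unitCircle hx₀ (hK r₂ h₂) _ hfin]
    refine mul_lt_mul_of_pos_left ?_ (ENNReal.toReal_pos hpos.ne' hfin.ne)
    simpa only [K, Nat.cast_one] using strictMonoOn_integral_circle_kernel hs h₁ h₂ h12
  · have hc : ∀ r ∈ Ioo 0 ‖x₀‖,
        ContinuousOn (fun y => K r (inner ℝ x₀ y / ‖x₀‖)) (sphere 0 1) := fun r hr =>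
      (hK r hr).comp (by fun_prop) fun y hy =>
        inner_div_norm_le_one x₀ (mem_sphere_zero_iff_norm.1 hy)
    exact integral_unitSphere_lt_of_forall_lt hfin hpos (hc r₁ h₁) (hc r₂ h₂) fun y hy =>
      strictMonoOn_rpow_mul_kernel (by exact_mod_cast hm) hs
        (inner_div_norm_le_one x₀ (mem_sphere_zero_iff_norm.1 hy)) h₁ h₂ h12
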